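/- A proper nonzero monomial ideal I of P is stable if and only if its minimal monomial generating set is a Pommaret basis of I. -/

import Mathlib

open MvPolynomial

/-- The (0-based) class of a nonzero exponent vector: the smallest index with
nonzero entry.  (The variables `x_1, …, x_n` of the paper are `X 0, …, X (n-1)`.) -/
noncomputable def cls {n : ℕ} (μ : Fin n →₀ ℕ) : ℕ :=
  sInf {i : ℕ | ∃ hi : i < n, μ ⟨i, hi⟩ ≠ 0}

/-- `x^μ` involutively divides `x^ν` : it divides it and the quotient only involves
the multiplicative variables `x_1, …, x_{cls μ}` of `x^μ`. -/
def InvDiv {n : ℕ} (μ ν : Fin n →₀ ℕ) : Prop :=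
  μ ≤ ν ∧ ∀ j : Fin n, ν j ≠ μ j → (j : ℕ) ≤ cls μ

/-- The exponent of the leading term of `f` with respect to the monomial order `m`. -/
noncomputable def ldeg {n : ℕ} {K : Type*} [Field K] (m : MonomialOrder (Fin n))
    (f : MvPolynomial (Fin n) K) : Fin n →₀ ℕ :=
  m.toSyn.symm (f.support.sup fun μ => m.toSyn μ)

/-- The leading ideal `lt(I)` of an ideal `I` with respect to `m`. -/
noncomputable def ltIdeal {n : ℕ} {K : Type*} [Field K] (m : MonomialOrder (Fin n))
    (I : Ideal (MvPolynomial (Fin n) K)) : Ideal (MvPolynomial (Fin n) K) :=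
  Ideal.span {g | ∃ f ∈ I, f ≠ 0 ∧ g = monomial (ldeg m f) (1 : K)}

/-- `H` is a (finite, monomial) Pommaret basis of the monomial ideal `I`:
it generates `I` and every monomial of `I` has a unique involutive divisor in `H`. -/
def IsMonPB {n : ℕ} {K : Type*} [Field K] (H : Set (Fin n →₀ ℕ))
    (I : Ideal (MvPolynomial (Fin n) K)) : Prop :=
  H.Finite ∧ I = Ideal.span ((fun μ => monomial μ (1 : K)) '' H) ∧
    ∀ ν : Fin n →₀ ℕ, monomial ν (1 : K) ∈ I → ∃! μ, μ ∈ H ∧ InvDiv μ ν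

/-- `H` is a Pommaret basis of the polynomial ideal `I` w.r.t. the monomial order `m`:
its elements lie in `I`, are nonzero with pairwise distinct leading terms, and the
leading terms form a Pommaret basis of the leading ideal. -/
def IsPB {n : ℕ} {K : Type*} [Field K] (m : MonomialOrder (Fin n))
    (H : Finset (MvPolynomial (Fin n) K)) (I : Ideal (MvPolynomial (Fin n) K)) : Prop :=
  (∀ h ∈ H, h ∈ I) ∧ (∀ h ∈ H, h ≠ 0) ∧
    Set.InjOn (fun h : MvPolynomial (Fin n) K => ldeg m h) ↑H ∧
    IsMonPB ((fun h : MvPolynomial (Fin n) K => ldeg m h) '' ↑H) (ltIdeal m I)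

/-- `m` is the degree reverse lexicographic order (with the reversed conventions of the
paper: for equal degrees, `μ ≺ ν` iff the first nonvanishing entry of `μ - ν` is positive). -/
def IsRevLex {n : ℕ} (m : MonomialOrder (Fin n)) : Prop :=
  ∀ μ ν : Fin n →₀ ℕ, m.toSyn μ < m.toSyn ν ↔
    ((μ.sum fun _ e => e) < (ν.sum fun _ e => e) ∨
      ((μ.sum fun _ e => e) = (ν.sum fun _ e => e) ∧
        ∃ i : Fin n, ν i < μ i ∧ ∀ j : Fin n, j < i → μ j = ν j))

/-- `I` is a homogeneous ideal. -/
def IsHomIdeal {n : ℕ} {K : Type*} [Field K] (I : Ideal (MvPolynomial (Fin n) K)) : Prop :=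
  ∃ S : Set (MvPolynomial (Fin n) K), (∀ f ∈ S, ∃ d, f.IsHomogeneous d) ∧ I = Ideal.span S

/-- The homogeneous maximal ideal `⟨x_1, …, x_n⟩`. -/
noncomputable def mxI (n : ℕ) (K : Type*) [Field K] : Ideal (MvPolynomial (Fin n) K) :=
  Ideal.span (Set.range X)

/-- The saturation `I : ⟨x_1,…,x_n⟩^∞` of `I`, as a set. -/
def satSet {n : ℕ} {K : Type*} [Field K] (I : Ideal (MvPolynomial (Fin n) K)) :
    Set (MvPolynomial (Fin n) K) :=
  {f | ∃ s : ℕ, ∀ g ∈ (mxI n K ^ s : Ideal (MvPolynomial (Fin n) K)), g * f ∈ I}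

/-- `I` is a monomial ideal. -/
def IsMonIdeal {n : ℕ} {K : Type*} [Field K] (I : Ideal (MvPolynomial (Fin n) K)) : Prop :=
  ∃ S : Set (Fin n →₀ ℕ), I = Ideal.span ((fun μ => monomial μ (1 : K)) '' S)

/-- A monomial ideal is quasi-stable if it possesses a finite Pommaret basis. -/
def QuasiStable {n : ℕ} {K : Type*} [Field K] (I : Ideal (MvPolynomial (Fin n) K)) : Prop :=
  ∃ H : Set (Fin n →₀ ℕ), IsMonPB H I

/-- A monomial ideal `I` is stable if for every monomial `t ∈ I` and every index
`cls t < i` also `x_i · t / x_{cls t} ∈ I`. -/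
def IsStable {n : ℕ} {K : Type*} [Field K] (I : Ideal (MvPolynomial (Fin n) K)) : Prop :=
  ∀ μ : Fin n →₀ ℕ, μ ≠ 0 → monomial μ (1 : K) ∈ I →
    ∀ c i : Fin n, (c : ℕ) = cls μ → c < i →
      monomial (μ - Finsupp.single c 1 + Finsupp.single i 1) (1 : K) ∈ I

theorem cls_spec {n : ℕ} {μ : Fin n →₀ ℕ} (h : μ ≠ 0) :
    ∃ c : Fin n, cls μ = c ∧ μ c ≠ 0 ∧ ∀ j, j < c → μ j = 0 := by
  have hne : {i : ℕ | ∃ hi : i < n, μ ⟨i, hi⟩ ≠ 0}.Nonempty := by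
    obtain ⟨j, hj⟩ := Finsupp.ne_iff.mp h
    exact ⟨j, j.2, by simpa using hj⟩
  obtain ⟨h1, h2⟩ := Nat.sInf_mem hne
  refine ⟨⟨_, h1⟩, rfl, h2, fun j hj => ?_⟩
  by_contra hc
  exact absurd (Nat.sInf_le (s := {i : ℕ | ∃ hi : i < n, μ ⟨i, hi⟩ ≠ 0}) ⟨j.2, hc⟩)
    (not_le.mpr hj)

theorem mon_mem_span {n : ℕ} {K : Type*} [Field K] (S : Set (Fin n →₀ ℕ)) (ν : Fin n →₀ ℕ) :
    monomial ν (1 : K) ∈ Ideal.span ((fun μ => monomial μ (1 : K)) '' S) ↔ ∃ s ∈ S, s ≤ ν := by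
  rw [mem_ideal_span_monomial_image]
  classical
  simp [support_monomial]

theorem mon_mem_up {n : ℕ} {K : Type*} [Field K] (I : Ideal (MvPolynomial (Fin n) K))
    {μ ν : Fin n →₀ ℕ} (h : μ ≤ ν) (hm : monomial μ (1 : K) ∈ I) : monomial ν (1 : K) ∈ I := by
  have : monomial ν (1 : K) = monomial (ν - μ) 1 * monomial μ 1 := by
    rw [monomial_mul, tsub_add_cancel_of_le h, one_mul]
  rw [this]
  exact I.mul_mem_left _ hm

theorem mon_mem_mx {n : ℕ} {K : Type*} [Field K] (I : Ideal (MvPolynomial (Fin n) K))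
    (hI : IsMonIdeal I) (ν : Fin n →₀ ℕ) :
    monomial ν (1 : K) ∈ mxI n K * I ↔
      ∃ i μ, monomial μ (1 : K) ∈ I ∧ μ + Finsupp.single i 1 = ν := by
  constructor
  · obtain ⟨S, rfl⟩ := hI
    intro h
    have e : mxI n K * Ideal.span ((fun μ => monomial μ (1 : K)) '' S) ≤
        Ideal.span ((fun μ => monomial μ (1 : K)) ''
          {τ | ∃ i, ∃ s ∈ S, τ = s + Finsupp.single i 1}) := by
      rw [mxI, Ideal.span_mul_span', Ideal.span_le]
      rintro _ ⟨_, ⟨i, rfl⟩, _, ⟨s, hs, rfl⟩, rfl⟩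
      apply Ideal.subset_span
      refine ⟨_, ⟨i, s, hs, rfl⟩, ?_⟩
      simp only [X, monomial_mul, one_mul]
      rw [add_comm]
    obtain ⟨_, ⟨i, s, hs, rfl⟩, hle⟩ := (mon_mem_span _ _).mp (e h)
    refine ⟨i, ν - Finsupp.single i 1, ?_, ?_⟩
    · exact (mon_mem_span _ _).mpr ⟨s, hs, le_tsub_of_add_le_right hle⟩
    · exact tsub_add_cancel_of_le (le_trans le_add_self hle)
  · rintro ⟨i, μ, hμ, rfl⟩
    have : monomial (μ + Finsupp.single i 1) (1 : K) = X i * monomial μ 1 := by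
      simp only [X, monomial_mul, one_mul]
      rw [add_comm]
    rw [this]
    exact Ideal.mul_mem_mul (Ideal.subset_span ⟨i, rfl⟩) hμ

theorem lt_step {n : ℕ} {μ ν : Fin n →₀ ℕ} (h : μ < ν) :
    ∃ i, ∃ τ, μ ≤ τ ∧ τ + Finsupp.single i 1 = ν := by
  obtain ⟨hle, i, hi⟩ := Finsupp.lt_def.mp h
  have h1 : Finsupp.single i 1 ≤ ν := by
    simp; omega
  refine ⟨i, ν - Finsupp.single i 1, ?_, tsub_add_cancel_of_le h1⟩
  intro j
  have := hle j
  by_cases hj : i = j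
  · subst hj; simp; omega
  · simp [Finsupp.single_apply, hj]; exact this

theorem inv_le {n : ℕ} {μ μ' ν : Fin n →₀ ℕ} (h0 : μ ≠ 0) (h0' : μ' ≠ 0)
    (h : InvDiv μ ν) (h' : InvDiv μ' ν) (hc : cls μ ≤ cls μ') : μ ≤ μ' ∨ μ' ≤ μ := by
  obtain ⟨c, e, -, hz⟩ := cls_spec h0
  obtain ⟨c', e', -, hz'⟩ := cls_spec h0'
  have key : ∀ j, c < j → ν j = μ j := fun j hj => by
    by_contra hne
    have := h.2 j hne
    rw [e] at this
    exact absurd hj (not_lt.mpr this)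
  have key' : ∀ j, c' < j → ν j = μ' j := fun j hj => by
    by_contra hne
    have := h'.2 j hne
    rw [e'] at this
    exact absurd hj (not_lt.mpr this)
  have hcc : c ≤ c' := by rw [e, e'] at hc; exact hc
  by_cases hx : μ' c' ≤ μ c'
  · right
    intro j
    rcases lt_trichotomy j c' with hj | rfl | hj
    · rw [hz' j hj]; exact Nat.zero_le _
    · exact hx
    · rw [← key' j hj, ← key j (lt_of_le_of_lt hcc hj)]
  · left
    have hcc2 : c = c' := by
      by_contra hne
      have := key c' (lt_of_le_of_ne hcc hne)
      have := h'.1 c'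
      omega
    subst hcc2
    intro j
    rcases lt_trichotomy j c with hj | rfl | hj
    · rw [hz j hj]; exact Nat.zero_le _
    · omega
    · rw [← key' j hj, ← key j hj]

theorem exists_inv {n : ℕ} (U : Set (Fin n →₀ ℕ)) (h0 : (0 : Fin n →₀ ℕ) ∉ U)
    (hst : ∀ μ ∈ U, ∀ c i : Fin n, (c : ℕ) = cls μ → c < i →
      μ - Finsupp.single c 1 + Finsupp.single i 1 ∈ U) (d : ℕ) :
    ∀ ν ∈ U, ν.degree = d → ∃ μ, (μ ∈ U ∧ ¬ ∃ i, ∃ τ, τ ∈ U ∧ τ + Finsupp.single i 1 = μ) ∧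
      InvDiv μ ν := by
  induction d with
  | zero =>
    intro ν hν hd
    rw [Finsupp.degree_eq_zero_iff] at hd
    exact absurd (hd ▸ hν) h0
  | succ d ih =>
    intro ν hν hd
    by_cases hm : ∃ i, ∃ τ, τ ∈ U ∧ τ + Finsupp.single i 1 = ν
    · obtain ⟨i, τ, hτ, rfl⟩ := hm
      have hτ0 : τ ≠ 0 := fun h => h0 (h ▸ hτ)
      obtain ⟨b, eb, hb, hbz⟩ := cls_spec hτ0
      -- a variable `c` of index at most the class that can be removed
      have : ∃ c : Fin n, ∃ ρ ∈ U, ρ + Finsupp.single c 1 = τ + Finsupp.single i 1 ∧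
          ∀ j, j < c → ρ j = 0 := by
        by_cases hbi : b < i
        · refine ⟨b, _, hst τ hτ b i eb.symm hbi, ?_, ?_⟩
          · rw [add_right_comm, tsub_add_cancel_of_le]
            simp; omega
          · intro j hj
            have h1 : i ≠ j := (hj.trans hbi).ne'
            simp [Finsupp.single_apply, h1, hbz j hj]
        · refine ⟨i, τ, hτ, rfl, fun j hj => hbz j (lt_of_lt_of_le hj (not_lt.mp hbi))⟩
      obtain ⟨c, ρ, hρ, he, hz⟩ := this
      rw [← he] at hd ⊢
      have hd' : ρ.degree = d := by
        rw [map_add, Finsupp.degree_single] at hd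
        omega
      obtain ⟨μ, hμ, hle, hinv⟩ := ih ρ hρ hd'
      refine ⟨μ, hμ, hle.trans le_self_add, ?_⟩
      intro j hj
      by_cases hjc : c = j
      · subst hjc
        obtain ⟨a, ea, ha, -⟩ := cls_spec (fun h => h0 (h ▸ hμ.1) : μ ≠ 0)
        rw [ea]
        by_contra hlt
        have h1 := hz a (by simpa using hlt)
        have h2 := hle a
        omega
      · apply hinv
        simpa [Finsupp.single_apply, hjc] using hj
    · exact ⟨ν, ⟨hν, hm⟩, le_rfl, fun j hj => absurd rfl hj⟩

/-- Lemma 3.5: a monomial ideal is stable iff its minimal monomial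
generating set (the monomials of `I` not in `𝔪·I`) is a Pommaret basis of `I`. -/
theorem statement13 {n : ℕ} {K : Type*} [Field K]
    (I : Ideal (MvPolynomial (Fin n) K)) (hImon : IsMonIdeal I) (hI0 : I ≠ ⊥) (hIT : I ≠ ⊤) :
    IsStable I ↔
      IsMonPB {μ : Fin n →₀ ℕ | monomial μ (1 : K) ∈ I ∧
        monomial μ (1 : K) ∉ (mxI n K * I : Ideal (MvPolynomial (Fin n) K))} I := by
  have h0 : monomial (0 : Fin n →₀ ℕ) (1 : K) ∉ I := fun h =>
    hIT ((Ideal.eq_top_iff_one I).mpr (by simpa using h))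
  have hH : ∀ μ : Fin n →₀ ℕ, (monomial μ (1 : K) ∈ I ∧
        monomial μ (1 : K) ∉ (mxI n K * I : Ideal (MvPolynomial (Fin n) K))) ↔
      (monomial μ (1 : K) ∈ I ∧ ¬ ∃ i τ, monomial τ (1 : K) ∈ I ∧
        τ + Finsupp.single i 1 = μ) := fun μ => by rw [mon_mem_mx I hImon]
  simp only [hH]
  have hmin : ∀ μ ν : Fin n →₀ ℕ, monomial μ (1 : K) ∈ I → (¬ ∃ i τ, monomial τ (1 : K) ∈ I ∧
        τ + Finsupp.single i 1 = ν) → μ ≤ ν → μ = ν := by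
    intro μ ν hμ hν hle
    by_contra hne
    obtain ⟨i, τ, h1, h2⟩ := lt_step (lt_of_le_of_ne hle hne)
    exact hν ⟨i, τ, mon_mem_up I h1 hμ, h2⟩
  constructor
  · intro hst
    have hex := fun d => exists_inv {μ : Fin n →₀ ℕ | monomial μ (1 : K) ∈ I} h0
      (fun μ hμ => hst μ (fun h => h0 (h ▸ hμ)) hμ) d
    refine ⟨?_, ?_, ?_⟩
    · apply WellQuasiOrderedLE.finite_of_isAntichain
      intro a ha b hb hab hle
      exact hab (hmin a b ha.1 hb.2 hle)
    · apply le_antisymm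
      · obtain ⟨S, hS⟩ := hImon
        conv_lhs => rw [hS]
        rw [Ideal.span_le]
        rintro _ ⟨s, hs, rfl⟩
        have hsI : monomial s (1 : K) ∈ I := by
          rw [hS]; exact Ideal.subset_span ⟨s, hs, rfl⟩
        obtain ⟨μ, hμ, hle, -⟩ := hex _ s hsI rfl
        exact (mon_mem_span _ _).mpr ⟨μ, hμ, hle⟩
      · rw [Ideal.span_le]
        rintro _ ⟨s, hs, rfl⟩
        exact hs.1
    · intro ν hν
      obtain ⟨μ, hμ, hd⟩ := hex _ ν hν rfl
      refine ⟨μ, ⟨hμ, hd⟩, ?_⟩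
      rintro μ' ⟨hμ', hd'⟩
      have n0 : μ ≠ 0 := fun h => h0 (h ▸ hμ.1)
      have n0' : μ' ≠ 0 := fun h => h0 (h ▸ hμ'.1)
      have hcomp : μ ≤ μ' ∨ μ' ≤ μ := by
        rcases le_total (cls μ) (cls μ') with hc | hc
        · exact inv_le n0 n0' hd hd' hc
        · exact (inv_le n0' n0 hd' hd hc).symm
      rcases hcomp with h | h
      · exact (hmin _ _ hμ.1 hμ'.2 h).symm
      · exact hmin _ _ hμ'.1 hμ.2 h
  · rintro ⟨-, -, hP⟩ μ hμ0 hμ c i hc hci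
    obtain ⟨h, ⟨hh, hle, hinv⟩, -⟩ := hP (μ + Finsupp.single i 1) (mon_mem_up I le_self_add hμ)
    obtain ⟨b, eb, hb, hbz⟩ := cls_spec hμ0
    have hcb : c = b := Fin.ext (hc.trans eb)
    subst hcb
    refine mon_mem_up I ?_ hh.1
    have hlt : h c < μ c + 1 := by
      have := hle c
      simp [Finsupp.single_apply, hci.ne'] at this
      omega
    by_cases hcc : h c = μ c
    · exfalso
      obtain ⟨a, ea, ha, haz⟩ := cls_spec (fun e => h0 (e ▸ hh.1) : h ≠ 0)
      have hac : a ≤ c := by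
        by_contra hlt
        have := haz c (not_le.mp hlt)
        omega
      refine hh.2 ⟨i, μ, hμ, ?_⟩
      ext j
      by_contra hne
      have h1 := hinv j hne
      rw [ea] at h1
      have h2 : j ≤ c := le_trans (show j ≤ a from h1) hac
      rcases h2.lt_or_eq with h3 | rfl
      · have h4 := hle j
        have h5 := hbz j h3
        have h6 : i ≠ j := (h3.trans hci).ne'
        simp [Finsupp.single_apply, h6, h5] at h4 hne
        omega
      · simp [Finsupp.single_apply, hci.ne', hcc] at hne
    · intro j
      have := hle j
      by_cases hj : c = j
      · subst hj
        simp
        omega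
      · simp [Finsupp.single_apply, hj] at this ⊢
        exact this
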